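/- arXiv:2505.01041 — 3 statements merged into one kernel-verified Lean document; each statement's English description precedes it below -/
import Mathlib

section
/- Let D ∈ ℝ^{d×d} be symmetric positive definite with σ_min(D) ≥ μ₀ > 0, let K ∈ ℝ^{k×d} with ‖K‖ ≤ K̄ for some K̄ > 0, and let σ > 0. Then the symmetric block matrix D̃ := [[D, −D Kᵀ], [−K D, K D Kᵀ + σ² I_k]] ∈ ℝ^{(d+k)×(d+k)} satisfies, for all a ∈ ℝ^d and b ∈ ℝ^k, (aᵀ, bᵀ) D̃ (a; b) ≥ min{μ₀/2, σ²/(8 K̄²), σ²/2} · (‖a‖² + ‖b‖²); in particular λ_min(D̃) ≥ min{μ₀/2, σ²/(8 K̄²), σ²/2} > 0. -/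
open Matrix

/-- Spectral (ℓ2-operator) norm of a real matrix. -/
noncomputable def spNorm {m n : ℕ} (M : Matrix (Fin m) (Fin n) ℝ) : ℝ :=
  ‖LinearMap.toContinuousLinearMap (Matrix.toEuclideanLin M)‖

/-- Smallest singular value of a real square matrix: `√(λ_min(Mᵀ M))`. -/
noncomputable def sigmaMin {n : ℕ} (M : Matrix (Fin n) (Fin n) ℝ) : ℝ :=
  Real.sqrt (sInf (spectrum ℝ (Mᵀ * M)))

/-- Smallest eigenvalue of a real square matrix. -/
noncomputable def lambdaMin {n : Type*} [Fintype n] [DecidableEq n]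
    (M : Matrix n n ℝ) : ℝ :=
  sInf (spectrum ℝ M)

lemma aux_eig {n : Type*} [Fintype n] [DecidableEq n] (M : Matrix n n ℝ) (l : ℝ)
    (h : l ∈ spectrum ℝ M) : ∃ v : n → ℝ, v ≠ 0 ∧ M *ᵥ v = l • v := by
  rw [← Matrix.spectrum_toLin', ← Module.End.hasEigenvalue_iff_mem_spectrum] at h
  obtain ⟨v, hv⟩ := h.exists_hasEigenvector
  exact ⟨v, hv.2, by simpa using hv.apply_eq_smul⟩

lemma aux_dot_pos {n : Type*} [Fintype n] (v : n → ℝ) (hv : v ≠ 0) : 0 < v ⬝ᵥ v := by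
  have h0 : 0 ≤ v ⬝ᵥ v := Finset.sum_nonneg fun i _ => mul_self_nonneg (v i)
  exact lt_of_le_of_ne h0 fun h => hv (dotProduct_self_eq_zero.1 h.symm)

lemma aux_D {d : ℕ} (D : Matrix (Fin d) (Fin d) ℝ) (hD : D.PosDef)
    (μ₀ : ℝ) (hDmin : μ₀ ≤ sigmaMin D) (u : Fin d → ℝ) :
    μ₀ * (u ⬝ᵥ u) ≤ u ⬝ᵥ (D *ᵥ u) := by
  have hT : Dᵀ = D := by simpa using hD.isHermitian.eq
  have hspec : ∀ l ∈ spectrum ℝ D, μ₀ ≤ l := by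
    intro l hl
    have hl0 : 0 ≤ l := by
      obtain ⟨v, hv, he⟩ := aux_eig D l hl
      have h1 := hD.posSemidef.dotProduct_mulVec_nonneg v
      rw [he] at h1
      simp only [star_trivial, dotProduct_smul, smul_eq_mul] at h1
      exact nonneg_of_mul_nonneg_left h1 (aux_dot_pos v hv)
    have h2 : l ^ 2 ∈ spectrum ℝ (Dᵀ * D) := by
      rw [hT, ← pow_two]
      exact spectrum.pow_mem_pow D 2 hl
    have h3 : sInf (spectrum ℝ (Dᵀ * D)) ≤ l ^ 2 :=
      csInf_le (Matrix.finite_real_spectrum).bddBelow h2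
    calc μ₀ ≤ _ := hDmin
      _ ≤ Real.sqrt (l ^ 2) := Real.sqrt_le_sqrt h3
      _ = l := Real.sqrt_sq hl0
  have hH : (D - μ₀ • 1).IsHermitian := by
    apply hD.isHermitian.sub
    simp [IsHermitian]
  have hP : (D - μ₀ • 1).PosSemidef := by
    rw [hH.posSemidef_iff_eigenvalues_nonneg]
    intro i
    have hm := hH.eigenvalues_mem_spectrum_real i
    obtain ⟨v, hv, he⟩ := aux_eig _ _ hm
    have he2 : D *ᵥ v = (hH.eigenvalues i + μ₀) • v := by
      rw [sub_mulVec, smul_mulVec, one_mulVec] at he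
      rw [add_smul, ← he]; abel
    have : hH.eigenvalues i + μ₀ ∈ spectrum ℝ D := by
      rw [← Matrix.spectrum_toLin', ← Module.End.hasEigenvalue_iff_mem_spectrum]
      exact Module.End.hasEigenvalue_of_hasEigenvector
        (x := v) ⟨by rw [Module.End.mem_eigenspace_iff]; simpa using he2, hv⟩
    have := hspec _ this
    simp; linarith
  have h := hP.dotProduct_mulVec_nonneg u
  rw [sub_mulVec, smul_mulVec, one_mulVec] at h
  simp only [star_trivial, dotProduct_smul, smul_eq_mul, dotProduct_sub] at h
  linarith

lemma aux_dot_norm {n : ℕ} (v : Fin n → ℝ) : v ⬝ᵥ v = ‖WithLp.toLp 2 v‖ ^ 2 := by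
  rw [EuclideanSpace.norm_sq_eq]
  simp [dotProduct, pow_two]

lemma aux_K {d k : ℕ} (K : Matrix (Fin k) (Fin d) ℝ) (Kbar : ℝ) (hK : spNorm K ≤ Kbar)
    (b : Fin k → ℝ) : (Kᵀ *ᵥ b) ⬝ᵥ (Kᵀ *ᵥ b) ≤ Kbar ^ 2 * (b ⬝ᵥ b) := by
  set w := Kᵀ *ᵥ b with hw
  have h1 : w ⬝ᵥ w = b ⬝ᵥ (K *ᵥ w) := by
    rw [dotProduct_mulVec b K w, ← mulVec_transpose K b]
  have h2 : ‖WithLp.toLp 2 (K *ᵥ w)‖ ≤ Kbar * ‖WithLp.toLp 2 w‖ := by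
    have := (LinearMap.toContinuousLinearMap (Matrix.toEuclideanLin K)).le_of_opNorm_le hK
      (WithLp.toLp 2 w)
    simpa using this
  have h3 : b ⬝ᵥ (K *ᵥ w) ≤ ‖WithLp.toLp 2 b‖ * ‖WithLp.toLp 2 (K *ᵥ w)‖ := by
    have := real_inner_le_norm (WithLp.toLp 2 b) (WithLp.toLp 2 (K *ᵥ w))
    rw [EuclideanSpace.inner_toLp_toLp, dotProduct_comm] at this
    simpa using this
  rw [← h1, aux_dot_norm w] at h3
  rw [aux_dot_norm w, aux_dot_norm b]
  have hb := norm_nonneg (WithLp.toLp 2 b)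
  have hwn := norm_nonneg (WithLp.toLp 2 w)
  have hK0 : 0 ≤ Kbar := le_trans (norm_nonneg _) hK
  generalize ‖WithLp.toLp 2 w‖ = x at *
  generalize ‖WithLp.toLp 2 b‖ = y at *
  have h4 : x ^ 2 ≤ y * (Kbar * x) := h3.trans (mul_le_mul_of_nonneg_left h2 hb)
  have h5 : x ≤ Kbar * y := by
    rcases hwn.eq_or_lt with h | h
    · rw [← h]; positivity
    · by_contra hc
      push Not at hc
      nlinarith
  calc x ^ 2 ≤ (Kbar * y) ^ 2 := pow_le_pow_left₀ hwn h5 2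
    _ = _ := by ring

/-- Quadratic-form lower bound for the joint covariance block matrix
`D̃ = [[D, −D Kᵀ], [−K D, K D Kᵀ + σ² I]]`, and the resulting eigenvalue bound. -/
theorem joint_covariance_lower_bound {d k : ℕ}
    (D : Matrix (Fin d) (Fin d) ℝ) (hD : D.PosDef)
    (μ₀ : ℝ) (hμ₀ : 0 < μ₀) (hDmin : μ₀ ≤ sigmaMin D)
    (K : Matrix (Fin k) (Fin d) ℝ) (Kbar : ℝ) (hKbar : 0 < Kbar) (hK : spNorm K ≤ Kbar)
    (σ : ℝ) (hσ : 0 < σ) :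
    (∀ (a : Fin d → ℝ) (b : Fin k → ℝ),
        min (μ₀ / 2) (min (σ ^ 2 / (8 * Kbar ^ 2)) (σ ^ 2 / 2)) * (a ⬝ᵥ a + b ⬝ᵥ b)
          ≤ Sum.elim a b ⬝ᵥ
              ((Matrix.fromBlocks D (-(D * Kᵀ)) (-(K * D)) (K * D * Kᵀ + σ ^ 2 • 1)) *ᵥ
                Sum.elim a b)) ∧
    min (μ₀ / 2) (min (σ ^ 2 / (8 * Kbar ^ 2)) (σ ^ 2 / 2))
      ≤ lambdaMin (Matrix.fromBlocks D (-(D * Kᵀ)) (-(K * D)) (K * D * Kᵀ + σ ^ 2 • 1)) ∧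
    0 < min (μ₀ / 2) (min (σ ^ 2 / (8 * Kbar ^ 2)) (σ ^ 2 / 2)) := by
  have hT : Dᵀ = D := by simpa using hD.isHermitian.eq
  have hc : 0 < min (μ₀ / 2) (min (σ ^ 2 / (8 * Kbar ^ 2)) (σ ^ 2 / 2)) := by positivity
  have hc1 : min (μ₀ / 2) (min (σ ^ 2 / (8 * Kbar ^ 2)) (σ ^ 2 / 2)) ≤ μ₀ / 2 := min_le_left _ _
  have hc2 : min (μ₀ / 2) (min (σ ^ 2 / (8 * Kbar ^ 2)) (σ ^ 2 / 2)) ≤ σ ^ 2 / (8 * Kbar ^ 2) :=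
    (min_le_right _ _).trans (min_le_left _ _)
  have hc3 : min (μ₀ / 2) (min (σ ^ 2 / (8 * Kbar ^ 2)) (σ ^ 2 / 2)) ≤ σ ^ 2 / 2 :=
    (min_le_right _ _).trans (min_le_right _ _)
  generalize min (μ₀ / 2) (min (σ ^ 2 / (8 * Kbar ^ 2)) (σ ^ 2 / 2)) = c at *
  rw [le_div_iff₀ (by positivity)] at hc2
  have main : ∀ (a : Fin d → ℝ) (b : Fin k → ℝ), c * (a ⬝ᵥ a + b ⬝ᵥ b)
          ≤ Sum.elim a b ⬝ᵥ
              ((Matrix.fromBlocks D (-(D * Kᵀ)) (-(K * D)) (K * D * Kᵀ + σ ^ 2 • 1)) *ᵥ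
                Sum.elim a b) := by
    intro a b
    have hk := aux_K K Kbar hK b
    have hd := aux_D D hD μ₀ hDmin (a - Kᵀ *ᵥ b)
    have e : Sum.elim a b ⬝ᵥ
              ((Matrix.fromBlocks D (-(D * Kᵀ)) (-(K * D)) (K * D * Kᵀ + σ ^ 2 • 1)) *ᵥ
                Sum.elim a b) =
        (a - Kᵀ *ᵥ b) ⬝ᵥ (D *ᵥ (a - Kᵀ *ᵥ b)) + σ ^ 2 * (b ⬝ᵥ b) := by
      have hx : ∀ x, (Kᵀ *ᵥ b) ⬝ᵥ x = b ⬝ᵥ (K *ᵥ x) := by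
        intro x
        rw [dotProduct_mulVec, ← mulVec_transpose]
      rw [fromBlocks_mulVec, sumElim_dotProduct_sumElim]
      simp only [Sum.elim_comp_inl, Sum.elim_comp_inr, mulVec_sub, sub_dotProduct, dotProduct_sub,
        hx, dotProduct_add, neg_mulVec, dotProduct_neg, add_mulVec, smul_mulVec, one_mulVec,
        dotProduct_smul, smul_eq_mul, ← mulVec_mulVec]
      ring
    rw [e]
    have hb : 0 ≤ b ⬝ᵥ b := Finset.sum_nonneg fun i _ => mul_self_nonneg (b i)
    have hu : 0 ≤ (a - Kᵀ *ᵥ b) ⬝ᵥ (a - Kᵀ *ᵥ b) :=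
      Finset.sum_nonneg fun i _ => mul_self_nonneg _
    have ha : a ⬝ᵥ a ≤ 2 * ((a - Kᵀ *ᵥ b) ⬝ᵥ (a - Kᵀ *ᵥ b)) +
        2 * ((Kᵀ *ᵥ b) ⬝ᵥ (Kᵀ *ᵥ b)) := by
      simp only [dotProduct, Finset.mul_sum, ← Finset.sum_add_distrib]
      refine Finset.sum_le_sum fun i _ => ?_
      simp only [Pi.sub_apply]
      nlinarith [sq_nonneg (a i - 2 * (Kᵀ *ᵥ b) i)]
    generalize (a - Kᵀ *ᵥ b) ⬝ᵥ (D *ᵥ (a - Kᵀ *ᵥ b)) = q at *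
    generalize (a - Kᵀ *ᵥ b) ⬝ᵥ (a - Kᵀ *ᵥ b) = U at *
    generalize (Kᵀ *ᵥ b) ⬝ᵥ (Kᵀ *ᵥ b) = W at *
    generalize b ⬝ᵥ b = B at *
    have ha2 : a ⬝ᵥ a ≤ 2 * U + 2 * (Kbar ^ 2 * B) := by linarith
    have p1 := mul_le_mul_of_nonneg_left ha2 hc.le
    have p2 := mul_le_mul_of_nonneg_right hc1 hu
    have p3 := mul_le_mul_of_nonneg_right hc2 hb
    have p4 := mul_le_mul_of_nonneg_right hc3 hb
    have p5 : 0 ≤ σ ^ 2 * B := by positivity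
    linarith
  refine ⟨main, ?_, hc⟩
  have hd : Nonempty (Fin d) := by
    by_contra h
    rw [not_nonempty_iff] at h
    have : sigmaMin D = 0 := by simp [sigmaMin, spectrum.of_subsingleton]
    linarith
  have hH : (Matrix.fromBlocks D (-(D * Kᵀ)) (-(K * D))
      (K * D * Kᵀ + σ ^ 2 • 1)).IsHermitian := by
    rw [IsHermitian, conjTranspose_eq_transpose_of_trivial, fromBlocks_transpose]
    simp [hT, transpose_mul, Matrix.mul_assoc]
  apply le_csInf
  · exact ⟨_, hH.eigenvalues_mem_spectrum_real (Sum.inl hd.some)⟩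
  · intro l hl
    obtain ⟨v, hv, he⟩ := aux_eig _ l hl
    have h := main (v ∘ Sum.inl) (v ∘ Sum.inr)
    rw [← sumElim_dotProduct_sumElim, Sum.elim_comp_inl_inr, he, dotProduct_smul,
      smul_eq_mul] at h
    exact le_of_mul_le_mul_right h (aux_dot_pos v hv)
end

section
/- Let D_0 ∈ ℝ^{d×d} be symmetric, σ > 0, A ∈ ℝ^{d×d}, B ∈ ℝ^{d×k}, K ∈ ℝ^{k×d}, D_σ := D_0 + σ² B Bᵀ, and suppose D ∈ ℝ^{d×d} satisfies the Lyapunov equation D = D_σ + (A − BK) D (A − BK)ᵀ. Define the block matrices D̃ := [[D, −D Kᵀ], [−K D, K D Kᵀ + σ² I_k]], D̃₀ := [[D_0, −D_0 Kᵀ], [−K D_0, K D_0 Kᵀ + σ² I_k]], and L := [[A, B], [−K A, −K B]] (all of size (d+k)×(d+k)). Then D̃ = L D̃ Lᵀ + D̃₀. -/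
open Matrix

/-- The joint state–action Lyapunov equation: if `D = D_σ + (A − BK) D (A − BK)ᵀ` with
`D_σ = D₀ + σ² B Bᵀ`, then the block matrix `D̃` satisfies `D̃ = L D̃ Lᵀ + D̃₀`. -/
theorem joint_lyapunov {d k : ℕ}
    (D0 : Matrix (Fin d) (Fin d) ℝ) (hD0 : D0.IsSymm) (σ : ℝ) (hσ : 0 < σ)
    (A : Matrix (Fin d) (Fin d) ℝ) (B : Matrix (Fin d) (Fin k) ℝ)
    (K : Matrix (Fin k) (Fin d) ℝ)
    (D : Matrix (Fin d) (Fin d) ℝ)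
    (hD : D = (D0 + σ ^ 2 • (B * Bᵀ)) + (A - B * K) * D * (A - B * K)ᵀ) :
    Matrix.fromBlocks D (-(D * Kᵀ)) (-(K * D)) (K * D * Kᵀ + σ ^ 2 • 1)
      = Matrix.fromBlocks A B (-(K * A)) (-(K * B)) *
          Matrix.fromBlocks D (-(D * Kᵀ)) (-(K * D)) (K * D * Kᵀ + σ ^ 2 • 1) *
          (Matrix.fromBlocks A B (-(K * A)) (-(K * B)))ᵀ +
        Matrix.fromBlocks D0 (-(D0 * Kᵀ)) (-(K * D0)) (K * D0 * Kᵀ + σ ^ 2 • 1) := by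
  have key : D - D0 = σ ^ 2 • (B * Bᵀ) + (A - B * K) * D * (A - B * K)ᵀ := by
    rw [sub_eq_iff_eq_add]
    refine hD.trans ?_
    abel
  rw [Matrix.fromBlocks_transpose, Matrix.fromBlocks_multiply, Matrix.fromBlocks_multiply,
    Matrix.fromBlocks_add, Matrix.fromBlocks_inj]
  refine ⟨?_, ?_, ?_, ?_⟩
  · rw [← sub_eq_iff_eq_add, key]
    simp only [Matrix.transpose_sub, Matrix.transpose_mul, Matrix.transpose_neg, Matrix.mul_add,
      Matrix.add_mul, Matrix.mul_sub, Matrix.sub_mul, Matrix.mul_neg, Matrix.neg_mul,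
      Matrix.mul_smul, Matrix.smul_mul, Matrix.mul_one, Matrix.mul_assoc, smul_neg]
    abel
  · rw [← sub_eq_iff_eq_add]
    have : -(D * Kᵀ) - -(D0 * Kᵀ) = -((D - D0) * Kᵀ) := by
      rw [Matrix.sub_mul]; abel
    rw [this, key]
    simp only [Matrix.transpose_sub, Matrix.transpose_mul, Matrix.transpose_neg, Matrix.mul_add,
      Matrix.add_mul, Matrix.mul_sub, Matrix.sub_mul, Matrix.mul_neg, Matrix.neg_mul,
      Matrix.mul_smul, Matrix.smul_mul, Matrix.mul_one, Matrix.mul_assoc, smul_neg]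
    abel
  · rw [← sub_eq_iff_eq_add]
    have : -(K * D) - -(K * D0) = -(K * (D - D0)) := by
      rw [Matrix.mul_sub]; abel
    rw [this, key]
    simp only [Matrix.transpose_sub, Matrix.transpose_mul, Matrix.transpose_neg, Matrix.mul_add,
      Matrix.add_mul, Matrix.mul_sub, Matrix.sub_mul, Matrix.mul_neg, Matrix.neg_mul,
      Matrix.mul_smul, Matrix.smul_mul, Matrix.mul_one, Matrix.mul_assoc, smul_neg]
    abel
  · rw [← sub_eq_iff_eq_add]
    have : K * D * Kᵀ + σ ^ 2 • (1 : Matrix (Fin k) (Fin k) ℝ) - (K * D0 * Kᵀ + σ ^ 2 • 1)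
        = K * (D - D0) * Kᵀ := by
      rw [Matrix.mul_sub, Matrix.sub_mul]; abel
    rw [this, key]
    simp only [Matrix.transpose_sub, Matrix.transpose_mul, Matrix.transpose_neg, Matrix.mul_add,
      Matrix.add_mul, Matrix.mul_sub, Matrix.sub_mul, Matrix.mul_neg, Matrix.neg_mul,
      Matrix.mul_smul, Matrix.smul_mul, Matrix.mul_one, Matrix.mul_assoc, smul_neg]
    abel
end

section
/- (Interconnected iteration system) Let A, B, C ≥ 0 and h₁, …, h₇ ≥ 0 be real numbers satisfying A ≤ h₁ + h₂ B + h₂ C, B ≤ h₃ + h₄ √(A B) + h₅ C, and C ≤ h₆ + h₇ √(B C). If h₂ h₄² + h₂ h₄² h₇² + 2 h₅ h₇² < 1, then B ≤ (2 h₃ + h₁ h₄² + 2 h₂ h₄² h₆ + 4 h₅ h₆) / (1 − h₂ h₄² − h₂ h₄² h₇² − 2 h₅ h₇²), C ≤ 2 h₆ + h₇² B, and A ≤ h₁ + h₂ B + h₂ C. -/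
/-- Interconnected iteration system: solving the coupled inequalities in `A`, `B`, `C`. -/
theorem interconnected_system (A B C h₁ h₂ h₃ h₄ h₅ h₆ h₇ : ℝ)
    (hA : 0 ≤ A) (hB : 0 ≤ B) (hC : 0 ≤ C)
    (h1 : 0 ≤ h₁) (h2 : 0 ≤ h₂) (h3 : 0 ≤ h₃) (h4 : 0 ≤ h₄) (h5 : 0 ≤ h₅)
    (h6 : 0 ≤ h₆) (h7 : 0 ≤ h₇)
    (hab : A ≤ h₁ + h₂ * B + h₂ * C)
    (hbc : B ≤ h₃ + h₄ * Real.sqrt (A * B) + h₅ * C)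
    (hca : C ≤ h₆ + h₇ * Real.sqrt (B * C))
    (hlt : h₂ * h₄ ^ 2 + h₂ * h₄ ^ 2 * h₇ ^ 2 + 2 * h₅ * h₇ ^ 2 < 1) :
    B ≤ (2 * h₃ + h₁ * h₄ ^ 2 + 2 * h₂ * h₄ ^ 2 * h₆ + 4 * h₅ * h₆) /
          (1 - h₂ * h₄ ^ 2 - h₂ * h₄ ^ 2 * h₇ ^ 2 - 2 * h₅ * h₇ ^ 2) ∧
    C ≤ 2 * h₆ + h₇ ^ 2 * B ∧
    A ≤ h₁ + h₂ * B + h₂ * C := by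
  have key : ∀ x y k : ℝ, 0 ≤ x → 0 ≤ y → 2 * (k * Real.sqrt (x * y)) ≤ k ^ 2 * x + y := by
    intro x y k hx hy
    rw [Real.sqrt_mul hx]
    nlinarith [sq_nonneg (k * Real.sqrt x - Real.sqrt y), Real.sq_sqrt hx, Real.sq_sqrt hy]
  have k1 := key A B h₄ hA hB
  have k2 := key B C h₇ hB hC
  have hC2 : C ≤ 2 * h₆ + h₇ ^ 2 * B := by linarith
  refine ⟨?_, hC2, hab⟩
  rw [le_div_iff₀ (by linarith)]
  have e1 := mul_le_mul_of_nonneg_left hab (sq_nonneg h₄)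
  have e2 := mul_le_mul_of_nonneg_left hC2 h5
  have e3 := mul_le_mul_of_nonneg_left hC2 (mul_nonneg h2 (sq_nonneg h₄))
  linarith
end
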